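/- Let γ ∈ (−3,−2), let s ∈ (0,2) and κ > 0, and set m(v) = exp(κ⟨v⟩^s). Then limsup_{|v|→∞} ζ_m(v) ⟨v⟩^{−s−γ} ≤ −2κs and limsup_{|v|→∞} ζ̃_m(v) ⟨v⟩^{−s−γ} ≤ −2κs. -/

import Mathlib

noncomputable section

open MeasureTheory Real Filter

abbrev V3 := EuclideanSpace ℝ (Fin 3)

/-- Japanese bracket ⟨v⟩ = (1+|v|²)^{1/2}. -/
def jap (v : V3) : ℝ := Real.sqrt (1 + ‖v‖ ^ 2)

/-- Standard Gaussian μ on ℝ³. -/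
def gaussM (v : V3) : ℝ := (2 * Real.pi) ^ (-(3 : ℝ) / 2) * Real.exp (-‖v‖ ^ 2 / 2)

/-- Landau kernel matrix a_{ij}(z). -/
def aker (γ : ℝ) (z : V3) (i j : Fin 3) : ℝ :=
  ‖z‖ ^ (γ + 2) * ((if i = j then (1 : ℝ) else 0) - z i * z j / ‖z‖ ^ 2)

/-- ā_{ij} = a_{ij} * μ. -/
def abar (γ : ℝ) (v : V3) (i j : Fin 3) : ℝ := ∫ w : V3, aker γ (v - w) i j * gaussM w

def bker (γ : ℝ) (z : V3) (i : Fin 3) : ℝ := -2 * ‖z‖ ^ γ * z i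

/-- b̄_i = b_i * μ. -/
def bbar (γ : ℝ) (v : V3) (i : Fin 3) : ℝ := ∫ w : V3, bker γ (v - w) i * gaussM w

/-- J_β(v) = ∫ |v−w|^β μ(w) dw. -/
def Jfun (β : ℝ) (v : V3) : ℝ := ∫ w : V3, ‖v - w‖ ^ β * gaussM w

/-- c̄(v) = −2(γ+3) J_γ(v). -/
def cbar (γ : ℝ) (v : V3) : ℝ := -2 * (γ + 3) * Jfun γ v

/-- ℓ₁(v). -/
def ell1 (γ : ℝ) (v : V3) : ℝ :=
  ∫ w : V3, (1 - ((∑ i, v i * w i) / (‖v‖ * ‖w‖)) ^ 2) * ‖w‖ ^ (γ + 2) * gaussM (v - w)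

/-- Squared Euclidean norm of the cross product of two vectors in ℝ³. -/
def crossSq (a b : V3) : ℝ :=
  ∑ i, (crossProduct (R := ℝ) (fun k => a k) (fun k => b k) i) ^ 2

/-- ℓ₂(v). -/
def ell2 (γ : ℝ) (v : V3) : ℝ :=
  ∫ w : V3,
    (1 - (1 / 2) * crossSq (‖v‖⁻¹ • v) (‖w‖⁻¹ • w)) * ‖w‖ ^ (γ + 2) * gaussM (v - w)

/-- Projection P_v ξ on the direction v. -/
def Pv (v ξ : V3) : V3 := ((∑ i, ξ i * v i) / ‖v‖ ^ 2) • v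

/-- Partial derivative in the i-th coordinate direction. -/
def pd (i : Fin 3) (f : V3 → ℝ) : V3 → ℝ := fun v => fderiv ℝ f v (EuclideanSpace.single i 1)

/-- Anisotropic gradient ∇̃f = P_v ∇f + ⟨v⟩ (I − P_v) ∇f. -/
def anisoGrad (f : V3 → ℝ) (v : V3) : V3 :=
  Pv v (gradient f v) + jap v • (gradient f v - Pv v (gradient f v))

/-- The filter |v| → ∞ on ℝ³. -/
def normAtTop : Filter V3 := Filter.comap (fun v : V3 => ‖v‖) Filter.atTop

/-- ζ_m(v) = Σ ā_{ij} ∂_{ij}m/m + Σ ā_{ij} (∂_i m/m)(∂_j m/m) + 2 Σ b̄_i ∂_i m/m − c̄/2. -/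
def zeta (γ : ℝ) (m : V3 → ℝ) (v : V3) : ℝ :=
  (∑ i, ∑ j, abar γ v i j * pd i (pd j m) v / m v)
  + (∑ i, ∑ j, abar γ v i j * (pd i m v / m v) * (pd j m v / m v))
  + 2 * (∑ i, bbar γ v i * pd i m v / m v)
  - cbar γ v / 2

/-- ζ̃_m(v) = Σ ā_{ij} (∂_i m/m)(∂_j m/m) + Σ b̄_i ∂_i m/m − c̄/2. -/
def zetaT (γ : ℝ) (m : V3 → ℝ) (v : V3) : ℝ :=
  (∑ i, ∑ j, abar γ v i j * (pd i m v / m v) * (pd j m v / m v))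
  + (∑ i, bbar γ v i * pd i m v / m v)
  - cbar γ v / 2

/-- ζ_{m,ω}(v). -/
def zetaMW (γ : ℝ) (m ω : V3 → ℝ) (v : V3) : ℝ :=
  (∑ i, ∑ j, abar γ v i j * pd i (pd j ω) v / ω v)
  + (∑ i, ∑ j, abar γ v i j * (pd i ω v / ω v) * (pd j ω v / ω v))
  - 2 * (∑ i, ∑ j, abar γ v i j * (pd i ω v / ω v) * (pd j m v / m v))

lemma jap_sq (v : V3) : jap v ^ 2 = 1 + ‖v‖ ^ 2 := Real.sq_sqrt (by positivity)

lemma one_le_jap (v : V3) : 1 ≤ jap v := Real.one_le_sqrt.2 (by nlinarith [sq_nonneg ‖v‖])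

lemma jap_pos (v : V3) : 0 < jap v := zero_lt_one.trans_le (one_le_jap v)

lemma norm_le_jap (v : V3) : ‖v‖ ≤ jap v := Real.le_sqrt_of_sq_le (by linarith)

lemma jap_le_one_add_norm (v : V3) : jap v ≤ 1 + ‖v‖ :=
  Real.sqrt_le_iff.2 ⟨by positivity, by nlinarith [norm_nonneg v]⟩

lemma normAtTop_eq_cobounded : normAtTop = Bornology.cobounded V3 := comap_norm_atTop

instance normAtTop_neBot : normAtTop.NeBot := by
  rw [normAtTop_eq_cobounded]; infer_instance

instance normAtTop_isCountablyGenerated : normAtTop.IsCountablyGenerated := by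
  unfold normAtTop; infer_instance

lemma tendsto_norm_normAtTop : Tendsto (fun v : V3 => ‖v‖) normAtTop atTop := tendsto_comap

lemma tendsto_jap_normAtTop : Tendsto jap normAtTop atTop :=
  tendsto_atTop_mono norm_le_jap tendsto_norm_normAtTop

lemma tendsto_jap_rpow_neg {r : ℝ} (hr : r < 0) :
    Tendsto (fun v => jap v ^ r) normAtTop (nhds 0) := by
  have := (tendsto_rpow_neg_atTop (neg_pos.2 hr)).comp tendsto_jap_normAtTop
  simpa [Function.comp_def] using this

lemma tendsto_norm_sub_div_jap (w : V3) :
    Tendsto (fun v => ‖v - w‖ / jap v) normAtTop (nhds 1) := by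
  have h0 : Tendsto (fun v => (1 + ‖w‖) * (jap v)⁻¹) normAtTop (nhds 0) := by
    simpa using (tendsto_inv_atTop_zero.comp tendsto_jap_normAtTop).const_mul (1 + ‖w‖)
  rw [← tendsto_sub_nhds_zero_iff]
  refine squeeze_zero_norm (fun v => ?_) h0
  have hj := jap_pos v
  rw [div_sub_one hj.ne', Real.norm_eq_abs, abs_div, abs_of_pos hj, div_eq_mul_inv]
  gcongr
  have h1 := norm_sub_norm_le v w
  have h2 := norm_sub_le v w
  have h3 := norm_le_jap v
  have h4 := jap_le_one_add_norm v
  rw [abs_le]; constructor <;> linarith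

lemma tendsto_jap_rpow_mul_norm_sub_rpow (β : ℝ) (w : V3) :
    Tendsto (fun v => jap v ^ (-β) * ‖v - w‖ ^ β) normAtTop (nhds 1) := by
  have h := (tendsto_norm_sub_div_jap w).rpow_const (p := β) (Or.inl one_ne_zero)
  rw [Real.one_rpow] at h
  refine h.congr fun v => ?_
  rw [Real.div_rpow (norm_nonneg _) (jap_pos v).le, Real.rpow_neg (jap_pos v).le]
  ring

lemma integrable_indicator_ball_norm_rpow {β : ℝ} (hβ : -3 < β) :
    Integrable (fun z : V3 => (Metric.ball (0 : V3) 1).indicator (fun z => ‖z‖ ^ β) z) := by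
  have h : (fun z : V3 => (Metric.ball (0 : V3) 1).indicator (fun z => ‖z‖ ^ β) z)
      = fun z : V3 => (Set.Iio (1 : ℝ)).indicator (fun r => r ^ β) ‖z‖ := by
    ext z; simp [Set.indicator]
  rw [h, integrable_fun_norm_addHaar volume (f := (Set.Iio (1 : ℝ)).indicator fun r => r ^ β)]
  have h2 : IntegrableOn (fun r : ℝ => r ^ (β + 2)) (Set.Ioo 0 1) :=
    (intervalIntegral.integrableOn_Ioo_rpow_iff one_pos).2 (by linarith)
  have h3 : Set.Ioo (0 : ℝ) 1 = Set.Ioi 0 ∩ Set.Iio 1 := rfl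
  rw [h3] at h2
  have h4 : IntegrableOn ((Set.Iio (1 : ℝ)).indicator fun r : ℝ => r ^ (β + 2)) (Set.Ioi 0) := by
    rw [IntegrableOn, integrable_indicator_iff measurableSet_Iio, IntegrableOn,
      Measure.restrict_restrict measurableSet_Iio, Set.inter_comm]
    exact h2
  refine h4.congr_fun (fun r hr => ?_) measurableSet_Ioi
  have hr' : (0 : ℝ) < r := hr
  by_cases h5 : r < 1
  · simp only [Set.indicator, Set.mem_Iio, h5, if_true, smul_eq_mul, finrank_euclideanSpace,
      Fintype.card_fin]
    rw [Real.rpow_add hr', mul_comm]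
    norm_num
  · simp [Set.indicator, h5]

/-- Far from the singularity the Japanese bracket is controlled by the distance to it. -/
lemma jap_le_mul_of_one_le {v w : V3} (h : 1 ≤ ‖v - w‖) :
    jap v ≤ ‖v - w‖ * (2 * (1 + ‖w‖)) := by
  have h1 := jap_le_one_add_norm v
  have h2 := norm_le_norm_sub_add v w
  nlinarith [norm_nonneg w]

lemma jap_le_mul_of_le_one {v w : V3} (h : ‖v - w‖ ≤ 1) : jap v ≤ 2 * (1 + ‖w‖) := by
  have h1 := jap_le_one_add_norm v
  have h2 := norm_le_norm_sub_add v w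
  nlinarith [norm_nonneg w]

lemma rpow_neg_le_cube {β x : ℝ} (hβ : β ∈ Set.Ioo (-3 : ℝ) 0) {y : ℝ} (hx : 0 ≤ x) (hy : 1 ≤ y)
    (hxy : x ≤ y) : x ^ (-β) ≤ y ^ 3 := by
  calc x ^ (-β) ≤ y ^ (-β) := Real.rpow_le_rpow hx hxy (by linarith [hβ.2])
    _ ≤ y ^ (3 : ℝ) := Real.rpow_le_rpow_of_exponent_le hy (by linarith [hβ.1])
    _ = y ^ 3 := by norm_cast

lemma jap_rpow_mul_le_of_one_le {β : ℝ} (hβ : β ∈ Set.Ioo (-3 : ℝ) 0) {v w : V3}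
    (h : 1 ≤ ‖v - w‖) : jap v ^ (-β) * ‖v - w‖ ^ β ≤ (2 * (1 + ‖w‖)) ^ 3 := by
  have h0 : 0 < ‖v - w‖ := by linarith
  have h1 : jap v ^ (-β) * ‖v - w‖ ^ β = (jap v / ‖v - w‖) ^ (-β) := by
    rw [Real.div_rpow (jap_pos v).le h0.le, Real.rpow_neg h0.le, div_inv_eq_mul]
  rw [h1]
  refine rpow_neg_le_cube hβ (by have := jap_pos v; positivity) (by linarith [norm_nonneg w]) ?_
  rw [div_le_iff₀ h0, mul_comm]
  exact jap_le_mul_of_one_le h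

lemma jap_rpow_le_of_le_one {β : ℝ} (hβ : β ∈ Set.Ioo (-3 : ℝ) 0) {v w : V3}
    (h : ‖v - w‖ ≤ 1) : jap v ^ (-β) ≤ (2 * (1 + ‖w‖)) ^ 3 :=
  rpow_neg_le_cube hβ (jap_pos v).le (by linarith [norm_nonneg w]) (jap_le_mul_of_le_one h)

section Convolution

variable {β C : ℝ} {g : V3 → ℝ}

lemma nonneg_of_decay (hg : ∀ w, |g w| ≤ C * ((1 + ‖w‖) ^ 8)⁻¹) : 0 ≤ C := by
  have := (abs_nonneg _).trans (hg 0)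
  simpa using this

lemma cube_mul_abs_le (hg : ∀ w, |g w| ≤ C * ((1 + ‖w‖) ^ 8)⁻¹) (w : V3) :
    (2 * (1 + ‖w‖)) ^ 3 * |g w| ≤ 8 * C * ((1 + ‖w‖) ^ 5)⁻¹ := by
  have hp : 0 < 1 + ‖w‖ := by positivity
  calc (2 * (1 + ‖w‖)) ^ 3 * |g w| ≤ (2 * (1 + ‖w‖)) ^ 3 * (C * ((1 + ‖w‖) ^ 8)⁻¹) := by
        gcongr; exact hg w
    _ = 8 * C * ((1 + ‖w‖) ^ 5)⁻¹ := by field_simp; ring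

lemma integrable_one_add_norm_pow_inv :
    Integrable (fun w : V3 => ((1 + ‖w‖) ^ 5)⁻¹) := by
  have := integrable_one_add_norm (E := V3) (μ := volume) (r := 5) (by simp; norm_num)
  refine this.congr (ae_of_all _ fun w => ?_)
  have hp : 0 ≤ 1 + ‖w‖ := by positivity
  simp only [Real.rpow_neg hp]
  norm_cast

lemma norm_far_le (hβ : β ∈ Set.Ioo (-3 : ℝ) 0)
    (hg : ∀ w, |g w| ≤ C * ((1 + ‖w‖) ^ 8)⁻¹) (v w : V3) :
    ‖(Metric.ball v 1)ᶜ.indicator (fun w => jap v ^ (-β) * ‖v - w‖ ^ β * g w) w‖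
      ≤ 8 * C * ((1 + ‖w‖) ^ 5)⁻¹ := by
  have hj := jap_pos v
  have hC := nonneg_of_decay hg
  by_cases h : w ∈ (Metric.ball v 1)ᶜ
  · rw [Set.indicator_of_mem h, norm_mul, Real.norm_of_nonneg (by positivity), Real.norm_eq_abs]
    refine le_trans ?_ (cube_mul_abs_le hg w)
    gcongr
    exact jap_rpow_mul_le_of_one_le hβ (by simpa [dist_eq_norm, norm_sub_rev] using h)
  · rw [Set.indicator_of_notMem h, norm_zero]; positivity

lemma norm_near_le (hβ : β ∈ Set.Ioo (-3 : ℝ) 0)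
    (hg : ∀ w, |g w| ≤ C * ((1 + ‖w‖) ^ 8)⁻¹) (v z : V3) :
    ‖(Metric.ball (0 : V3) 1).indicator (fun z => jap v ^ (-β) * ‖z‖ ^ β * g (v - z)) z‖
      ≤ (8 * C * ((1 + ‖v - z‖) ^ 5)⁻¹) *
        (Metric.ball (0 : V3) 1).indicator (fun z => ‖z‖ ^ β) z := by
  have hj := jap_pos v
  by_cases h : z ∈ Metric.ball (0 : V3) 1
  · rw [Set.indicator_of_mem h, Set.indicator_of_mem h, norm_mul,
      Real.norm_of_nonneg (by positivity), Real.norm_eq_abs, mul_right_comm]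
    refine mul_le_mul_of_nonneg_right (le_trans ?_ (cube_mul_abs_le hg (v - z))) (by positivity)
    gcongr
    exact jap_rpow_le_of_le_one hβ (by simpa using (mem_ball_zero_iff.1 h).le)
  · simp [Set.indicator_of_notMem h]

lemma near_eq (v z : V3) :
    (Metric.ball (0 : V3) 1).indicator (fun z => jap v ^ (-β) * ‖z‖ ^ β * g (v - z)) z
      = (Metric.ball v 1).indicator (fun w => jap v ^ (-β) * ‖v - w‖ ^ β * g w) (v - z) := by
  simp [Set.indicator, dist_eq_norm]

lemma integrable_far (hβ : β ∈ Set.Ioo (-3 : ℝ) 0) (hm : Measurable g)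
    (hg : ∀ w, |g w| ≤ C * ((1 + ‖w‖) ^ 8)⁻¹) (v : V3) :
    Integrable ((Metric.ball v 1)ᶜ.indicator fun w => jap v ^ (-β) * ‖v - w‖ ^ β * g w) := by
  refine (integrable_one_add_norm_pow_inv.const_mul (8 * C)).mono' ?_
    (ae_of_all _ (norm_far_le hβ hg v))
  exact (Measurable.indicator (by fun_prop) measurableSet_ball.compl).aestronglyMeasurable

lemma near_le_const (hβ : β ∈ Set.Ioo (-3 : ℝ) 0)
    (hg : ∀ w, |g w| ≤ C * ((1 + ‖w‖) ^ 8)⁻¹) (v z : V3) :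
    ‖(Metric.ball (0 : V3) 1).indicator (fun z => jap v ^ (-β) * ‖z‖ ^ β * g (v - z)) z‖
      ≤ 8 * C * (Metric.ball (0 : V3) 1).indicator (fun z => ‖z‖ ^ β) z := by
  refine (norm_near_le hβ hg v z).trans ?_
  have hC := nonneg_of_decay hg
  refine mul_le_mul_of_nonneg_right (mul_le_of_le_one_right (by positivity) ?_)
    (Set.indicator_nonneg (fun _ _ => by positivity) _)
  exact inv_le_one_of_one_le₀ (one_le_pow₀ (by linarith [norm_nonneg (v - z)]))

lemma aestronglyMeasurable_near (hm : Measurable g) (v : V3) :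
    AEStronglyMeasurable
      ((Metric.ball (0 : V3) 1).indicator fun z => jap v ^ (-β) * ‖z‖ ^ β * g (v - z)) :=
  (Measurable.indicator (by fun_prop) measurableSet_ball).aestronglyMeasurable

lemma integrable_near (hβ : β ∈ Set.Ioo (-3 : ℝ) 0) (hm : Measurable g)
    (hg : ∀ w, |g w| ≤ C * ((1 + ‖w‖) ^ 8)⁻¹) (v : V3) :
    Integrable ((Metric.ball v 1).indicator fun w => jap v ^ (-β) * ‖v - w‖ ^ β * g w) := by
  rw [← integrable_comp_sub_left _ v]
  simp_rw [← near_eq]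
  exact ((integrable_indicator_ball_norm_rpow hβ.1).const_mul (8 * C)).mono'
    (aestronglyMeasurable_near hm v) (ae_of_all _ (near_le_const hβ hg v))

lemma integrable_jap_rpow_mul_norm_sub_rpow (hβ : β ∈ Set.Ioo (-3 : ℝ) 0) (hm : Measurable g)
    (hg : ∀ w, |g w| ≤ C * ((1 + ‖w‖) ^ 8)⁻¹) (v : V3) :
    Integrable fun w => jap v ^ (-β) * ‖v - w‖ ^ β * g w := by
  have := (integrable_near hβ hm hg v).add (integrable_far hβ hm hg v)
  rwa [Set.indicator_self_add_compl] at this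

lemma integrable_norm_sub_rpow_mul (hβ : β ∈ Set.Ioo (-3 : ℝ) 0) (hm : Measurable g)
    (hg : ∀ w, |g w| ≤ C * ((1 + ‖w‖) ^ 8)⁻¹) (v : V3) :
    Integrable fun w => ‖v - w‖ ^ β * g w := by
  have hj := Real.rpow_pos_of_pos (jap_pos v) (-β)
  have := (integrable_jap_rpow_mul_norm_sub_rpow hβ hm hg v).const_mul (jap v ^ (-β))⁻¹
  refine this.congr (ae_of_all _ fun w => ?_)
  field_simp

lemma tendsto_near (hβ : β ∈ Set.Ioo (-3 : ℝ) 0) (hm : Measurable g)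
    (hg : ∀ w, |g w| ≤ C * ((1 + ‖w‖) ^ 8)⁻¹) :
    Tendsto (fun v => ∫ z,
      (Metric.ball (0 : V3) 1).indicator (fun z => jap v ^ (-β) * ‖z‖ ^ β * g (v - z)) z)
      normAtTop (nhds 0) := by
  rw [← integral_zero V3 ℝ (μ := volume)]
  refine tendsto_integral_filter_of_dominated_convergence
    (fun z => 8 * C * (Metric.ball (0 : V3) 1).indicator (fun z => ‖z‖ ^ β) z)
    (Eventually.of_forall (aestronglyMeasurable_near hm))
    (Eventually.of_forall fun v => ae_of_all _ (near_le_const hβ hg v))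
    ((integrable_indicator_ball_norm_rpow hβ.1).const_mul (8 * C)) (ae_of_all _ fun z => ?_)
  refine squeeze_zero_norm (fun v => norm_near_le hβ hg v z) ?_
  have h1 : Tendsto (fun v : V3 => 1 + ‖v - z‖) normAtTop atTop := by
    refine tendsto_atTop_mono (fun v => ?_)
      (tendsto_atTop_add_const_right _ (-‖z‖) tendsto_norm_normAtTop)
    linarith [norm_sub_norm_le v z]
  have h2 := tendsto_inv_atTop_zero.comp ((tendsto_pow_atTop (n := 5) (by norm_num)).comp h1)
  simpa using (h2.const_mul (8 * C)).mul_const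
    ((Metric.ball (0 : V3) 1).indicator (fun z => ‖z‖ ^ β) z)

lemma tendsto_far (hβ : β ∈ Set.Ioo (-3 : ℝ) 0) (hm : Measurable g)
    (hg : ∀ w, |g w| ≤ C * ((1 + ‖w‖) ^ 8)⁻¹) :
    Tendsto (fun v => ∫ w,
      (Metric.ball v 1)ᶜ.indicator (fun w => jap v ^ (-β) * ‖v - w‖ ^ β * g w) w)
      normAtTop (nhds (∫ w, g w)) := by
  refine tendsto_integral_filter_of_dominated_convergence
    (fun w => 8 * C * ((1 + ‖w‖) ^ 5)⁻¹)
    (Eventually.of_forall fun v => (integrable_far hβ hm hg v).aestronglyMeasurable)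
    (Eventually.of_forall fun v => ae_of_all _ (norm_far_le hβ hg v))
    (integrable_one_add_norm_pow_inv.const_mul _) (ae_of_all _ fun w => ?_)
  have h := (tendsto_jap_rpow_mul_norm_sub_rpow β w).mul_const (g w)
  rw [one_mul] at h
  refine h.congr' ?_
  filter_upwards [tendsto_norm_normAtTop.eventually_ge_atTop (1 + ‖w‖)] with v hv
  rw [Set.indicator_of_mem]
  have := norm_sub_norm_le v w
  simp only [Set.mem_compl_iff, Metric.mem_ball, dist_eq_norm, not_lt]
  rw [norm_sub_rev]; linarith

/-- Convolving `‖·‖ ^ β` with a rapidly decaying function `g` yields `(∫ g) * ⟨v⟩ ^ β` to leading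
order at infinity. -/
lemma tendsto_jap_rpow_mul_integral (hβ : β ∈ Set.Ioo (-3 : ℝ) 0) (hm : Measurable g)
    (hg : ∀ w, |g w| ≤ C * ((1 + ‖w‖) ^ 8)⁻¹) :
    Tendsto (fun v => jap v ^ (-β) * ∫ w, ‖v - w‖ ^ β * g w) normAtTop (nhds (∫ w, g w)) := by
  have h := (tendsto_near hβ hm hg).add (tendsto_far hβ hm hg)
  rw [zero_add] at h
  refine h.congr fun v => ?_
  simp_rw [near_eq]
  rw [integral_sub_left_eq_self (fun w =>
    (Metric.ball v 1).indicator (fun w => jap v ^ (-β) * ‖v - w‖ ^ β * g w) w) volume v,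
    ← integral_add (integrable_near hβ hm hg v) (integrable_far hβ hm hg v),
    ← integral_const_mul]
  congr 1 with w
  rw [Set.indicator_self_add_compl_apply, mul_assoc]

end Convolution

lemma gaussM_nonneg (v : V3) : 0 ≤ gaussM v := by unfold gaussM; positivity

lemma measurable_gaussM : Measurable gaussM := by unfold gaussM; fun_prop

lemma integral_gaussM : ∫ w, gaussM w = 1 := by
  have h := GaussianFourier.integral_rexp_neg_mul_sq_norm (V := V3) (b := 1 / 2) (by norm_num)
  have h2 : ∀ w : V3, gaussM w
      = (2 * Real.pi) ^ (-(3 : ℝ) / 2) * Real.exp (-(1 / 2) * ‖w‖ ^ 2) := fun w => by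
    unfold gaussM; congr 2; ring
  simp_rw [h2]
  rw [integral_const_mul, h]
  have h3 : Real.pi / (1 / 2) = 2 * Real.pi := by ring
  rw [h3, ← Real.rpow_add (by positivity)]
  simp
  norm_num

lemma exists_pow_mul_gaussM_le : ∃ C, ∀ w, (1 + ‖w‖) ^ 10 * gaussM w ≤ C := by
  refine ⟨(2 * Real.pi) ^ (-(3 : ℝ) / 2) * (4 ^ 5 * 120 * Real.exp (1 / 2)), fun w => ?_⟩
  have h1 := Real.pow_div_factorial_le_exp ((1 + ‖w‖ ^ 2) / 2) (by positivity) 5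
  have h2 : ((1 + ‖w‖ ^ 2) / 2) ^ 5 ≤ 120 * Real.exp ((1 + ‖w‖ ^ 2) / 2) := by
    rw [div_le_iff₀ (by positivity)] at h1
    norm_num [Nat.factorial] at h1 ⊢
    linarith
  have h3 : (1 + ‖w‖) ^ 2 ≤ 4 * ((1 + ‖w‖ ^ 2) / 2) := by nlinarith [sq_nonneg (1 - ‖w‖)]
  have h4 : (1 + ‖w‖) ^ 10 ≤ 4 ^ 5 * (120 * Real.exp ((1 + ‖w‖ ^ 2) / 2)) := by
    calc (1 + ‖w‖) ^ 10 = ((1 + ‖w‖) ^ 2) ^ 5 := by ring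
      _ ≤ (4 * ((1 + ‖w‖ ^ 2) / 2)) ^ 5 := by gcongr
      _ = 4 ^ 5 * ((1 + ‖w‖ ^ 2) / 2) ^ 5 := by ring
      _ ≤ _ := by gcongr
  have h5 : Real.exp ((1 + ‖w‖ ^ 2) / 2) * Real.exp (-‖w‖ ^ 2 / 2) = Real.exp (1 / 2) := by
    rw [← Real.exp_add]; congr 1; ring
  unfold gaussM
  calc (1 + ‖w‖) ^ 10 * ((2 * Real.pi) ^ (-(3 : ℝ) / 2) * Real.exp (-‖w‖ ^ 2 / 2))
      ≤ (4 ^ 5 * (120 * Real.exp ((1 + ‖w‖ ^ 2) / 2)))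
        * ((2 * Real.pi) ^ (-(3 : ℝ) / 2) * Real.exp (-‖w‖ ^ 2 / 2)) := by gcongr
    _ = (2 * Real.pi) ^ (-(3 : ℝ) / 2) * (4 ^ 5 * 120 *
        (Real.exp ((1 + ‖w‖ ^ 2) / 2) * Real.exp (-‖w‖ ^ 2 / 2))) := by ring
    _ = _ := by rw [h5]

section Gaussian

variable {β D : ℝ} {f : V3 → ℝ}

lemma exists_decay_mul_gaussM (hf : ∀ w, |f w| ≤ D * (1 + ‖w‖) ^ 2) :
    ∃ C, ∀ w, |f w * gaussM w| ≤ C * ((1 + ‖w‖) ^ 8)⁻¹ := by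
  obtain ⟨C, hC⟩ := exists_pow_mul_gaussM_le
  have hD : 0 ≤ D := by simpa using (abs_nonneg _).trans (hf 0)
  refine ⟨D * C, fun w => ?_⟩
  have hg := gaussM_nonneg w
  have hp : 0 < (1 + ‖w‖) ^ 8 := by positivity
  rw [abs_mul, abs_of_nonneg hg, ← div_eq_mul_inv, le_div_iff₀ hp]
  calc |f w| * gaussM w * (1 + ‖w‖) ^ 8
      ≤ (D * (1 + ‖w‖) ^ 2) * gaussM w * (1 + ‖w‖) ^ 8 := by gcongr; exact hf w
    _ = D * ((1 + ‖w‖) ^ 10 * gaussM w) := by ring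
    _ ≤ D * C := by gcongr; exact hC w

lemma integrable_norm_sub_rpow_mul_gaussM (hβ : β ∈ Set.Ioo (-3 : ℝ) 0) (hm : Measurable f)
    (hf : ∀ w, |f w| ≤ D * (1 + ‖w‖) ^ 2) (v : V3) :
    Integrable fun w => ‖v - w‖ ^ β * (f w * gaussM w) := by
  obtain ⟨C, hC⟩ := exists_decay_mul_gaussM hf
  exact integrable_norm_sub_rpow_mul hβ (hm.mul measurable_gaussM) hC v

lemma tendsto_jap_rpow_mul_integral_gaussM (hβ : β ∈ Set.Ioo (-3 : ℝ) 0) (hm : Measurable f)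
    (hf : ∀ w, |f w| ≤ D * (1 + ‖w‖) ^ 2) :
    Tendsto (fun v => jap v ^ (-β) * ∫ w, ‖v - w‖ ^ β * (f w * gaussM w)) normAtTop
      (nhds (∫ w, f w * gaussM w)) := by
  obtain ⟨C, hC⟩ := exists_decay_mul_gaussM hf
  exact tendsto_jap_rpow_mul_integral hβ (hm.mul measurable_gaussM) hC

/-- The second-moment analogue of `Jfun`. -/
def Kfun (β : ℝ) (v : V3) : ℝ := ∫ w : V3, ‖v - w‖ ^ β * (‖w‖ ^ 2 * gaussM w)

lemma norm_sq_le_one_add_sq (w : V3) : |‖w‖ ^ 2| ≤ 1 * (1 + ‖w‖) ^ 2 := by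
  rw [abs_of_nonneg (by positivity), one_mul]
  gcongr
  linarith

lemma one_le_one_add_sq (w : V3) : |(1 : ℝ)| ≤ 1 * (1 + ‖w‖) ^ 2 := by
  rw [abs_one, one_mul]
  exact one_le_pow₀ (by linarith [norm_nonneg w])

lemma integrable_Jfun (hβ : β ∈ Set.Ioo (-3 : ℝ) 0) (v : V3) :
    Integrable fun w => ‖v - w‖ ^ β * gaussM w := by
  simpa using integrable_norm_sub_rpow_mul_gaussM hβ measurable_const one_le_one_add_sq v

lemma integrable_Kfun (hβ : β ∈ Set.Ioo (-3 : ℝ) 0) (v : V3) :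
    Integrable fun w => ‖v - w‖ ^ β * (‖w‖ ^ 2 * gaussM w) :=
  integrable_norm_sub_rpow_mul_gaussM hβ (by fun_prop) norm_sq_le_one_add_sq v

lemma tendsto_Jfun (hβ : β ∈ Set.Ioo (-3 : ℝ) 0) :
    Tendsto (fun v => jap v ^ (-β) * Jfun β v) normAtTop (nhds 1) := by
  have := tendsto_jap_rpow_mul_integral_gaussM hβ measurable_const one_le_one_add_sq
  simpa [integral_gaussM, Jfun] using this

lemma tendsto_Kfun (hβ : β ∈ Set.Ioo (-3 : ℝ) 0) :
    Tendsto (fun v => jap v ^ (-β) * Kfun β v) normAtTop (nhds (∫ w : V3, ‖w‖ ^ 2 * gaussM w)) :=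
  tendsto_jap_rpow_mul_integral_gaussM hβ (by fun_prop) norm_sq_le_one_add_sq

end Gaussian

section Coefficients

lemma norm_sq_eq_sum_three (z : V3) : ‖z‖ ^ 2 = z 0 ^ 2 + z 1 ^ 2 + z 2 ^ 2 := by
  rw [EuclideanSpace.real_norm_sq_eq, Fin.sum_univ_three]

lemma abs_coord_le_norm (z : V3) (i : Fin 3) : |z i| ≤ ‖z‖ := by
  simpa using PiLp.norm_apply_le z i

lemma measurable_coord (i : Fin 3) : Measurable fun z : V3 => z i := by fun_prop

lemma abs_projection_entry_le (z : V3) (i j : Fin 3) :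
    |(if i = j then (1 : ℝ) else 0) - z i * z j / ‖z‖ ^ 2| ≤ 2 := by
  have h1 : |z i * z j / ‖z‖ ^ 2| ≤ 1 := by
    rw [abs_div, abs_mul, abs_of_nonneg (sq_nonneg ‖z‖), pow_two]
    exact div_le_one_of_le₀ (mul_le_mul (abs_coord_le_norm z i) (abs_coord_le_norm z j)
      (abs_nonneg _) (norm_nonneg _)) (by positivity)
  have h2 : |(if i = j then (1 : ℝ) else 0)| ≤ 1 := by split_ifs <;> simp
  exact (abs_sub _ _).trans (by linarith)

variable {γ : ℝ}

lemma integrable_aker (hγ : γ ∈ Set.Ioo (-3 : ℝ) (-2)) (v : V3) (i j : Fin 3) :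
    Integrable fun w => aker γ (v - w) i j * gaussM w := by
  have h := integrable_norm_sub_rpow_mul_gaussM (β := γ + 2) (D := 2)
    (f := fun w => (if i = j then (1 : ℝ) else 0) - (v - w) i * (v - w) j / ‖v - w‖ ^ 2)
    ⟨by linarith [hγ.1], by linarith [hγ.2]⟩ ?_ ?_ v
  · simpa only [aker, mul_assoc] using h
  · have h1 : Measurable fun z : V3 => (if i = j then (1 : ℝ) else 0) - z i * z j / ‖z‖ ^ 2 := by
      fun_prop
    exact h1.comp (measurable_const.sub measurable_id)
  · intro w
    refine (abs_projection_entry_le (v - w) i j).trans ?_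
    nlinarith [norm_nonneg w]

lemma integrable_bker (hγ : γ ∈ Set.Ioo (-3 : ℝ) (-2)) (v : V3) (i : Fin 3) :
    Integrable fun w => bker γ (v - w) i * gaussM w := by
  have h := integrable_norm_sub_rpow_mul_gaussM (β := γ) (D := 2 * (1 + ‖v‖))
    (f := fun w => -2 * (v - w) i) ⟨hγ.1, by linarith [hγ.2]⟩ ?_ ?_ v
  · refine h.congr (ae_of_all _ fun w => ?_)
    simp only [bker]; ring
  · exact ((measurable_coord i).comp (measurable_const.sub measurable_id)).const_mul (-2)
  · intro w
    have h1 := (abs_coord_le_norm (v - w) i).trans (norm_sub_le v w)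
    have hv := norm_nonneg v
    have hw := norm_nonneg w
    rw [abs_mul, abs_neg, abs_two, mul_assoc]
    refine mul_le_mul_of_nonneg_left (h1.trans ?_) (by norm_num)
    nlinarith [mul_nonneg hv hw, mul_nonneg hv (sq_nonneg ‖w‖)]

lemma sum_aker_diag (hγ : γ ∈ Set.Ioo (-3 : ℝ) (-2)) (z : V3) :
    ∑ i, aker γ z i i = 2 * ‖z‖ ^ (γ + 2) := by
  by_cases hz : ‖z‖ = 0
  · have : γ + 2 ≠ 0 := by linarith [hγ.2]
    simp [aker, hz, Real.zero_rpow this]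
  · have h := norm_sq_eq_sum_three z
    simp only [aker, Fin.sum_univ_three, if_true]
    field_simp
    rw [h]; ring

lemma sum_aker_mul_mul_mem (hγ : γ ∈ Set.Ioo (-3 : ℝ) (-2)) (v w : V3) :
    (∑ i, ∑ j, aker γ (v - w) i j * (v i * v j)) ∈
      Set.Icc 0 (‖v - w‖ ^ (γ + 2) * ‖w‖ ^ 2) := by
  by_cases hz : ‖v - w‖ = 0
  · have : γ + 2 ≠ 0 := by linarith [hγ.2]
    simp [aker, hz, Real.zero_rpow this]
  have hz2 : 0 < ‖v - w‖ ^ 2 := by positivity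
  have h1 := norm_sq_eq_sum_three (v - w)
  have h2 := norm_sq_eq_sum_three w
  simp only [PiLp.sub_apply] at h1
  have key : (∑ i, ∑ j, aker γ (v - w) i j * (v i * v j)) = ‖v - w‖ ^ (γ + 2) *
      (‖w‖ ^ 2 - ((v 0 - w 0) * w 0 + (v 1 - w 1) * w 1 + (v 2 - w 2) * w 2) ^ 2
        / ‖v - w‖ ^ 2) := by
    simp only [aker, Fin.sum_univ_three, PiLp.sub_apply, Fin.isValue, Fin.reduceEq, if_true,
      if_false]
    field_simp
    rw [h2]
    simp only [h1]
    ring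
  have hq := Real.rpow_nonneg (norm_nonneg (v - w)) (γ + 2)
  rw [key]
  constructor
  · refine mul_nonneg hq ?_
    rw [sub_nonneg, div_le_iff₀ hz2, h1, h2]
    nlinarith [sq_nonneg ((v 0 - w 0) * w 1 - (v 1 - w 1) * w 0),
      sq_nonneg ((v 0 - w 0) * w 2 - (v 2 - w 2) * w 0),
      sq_nonneg ((v 1 - w 1) * w 2 - (v 2 - w 2) * w 1)]
  · refine mul_le_mul_of_nonneg_left ?_ hq
    have : 0 ≤ ((v 0 - w 0) * w 0 + (v 1 - w 1) * w 1 + (v 2 - w 2) * w 2) ^ 2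
        / ‖v - w‖ ^ 2 := by positivity
    linarith

lemma sum_abar_diag (hγ : γ ∈ Set.Ioo (-3 : ℝ) (-2)) (v : V3) :
    ∑ i, abar γ v i i = 2 * Jfun (γ + 2) v := by
  simp only [abar, Jfun]
  rw [← integral_finsetSum _ fun i _ => integrable_aker hγ v i i, ← integral_const_mul]
  congr 1 with w
  rw [← Finset.sum_mul, sum_aker_diag hγ, mul_assoc]

lemma sum_abar_mul_mul_mem (hγ : γ ∈ Set.Ioo (-3 : ℝ) (-2)) (v : V3) :
    (∑ i, ∑ j, abar γ v i j * (v i * v j)) ∈ Set.Icc 0 (Kfun (γ + 2) v) := by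
  have hi : ∀ i j, Integrable fun w => aker γ (v - w) i j * gaussM w * (v i * v j) :=
    fun i j => (integrable_aker hγ v i j).mul_const _
  have h : (∑ i, ∑ j, abar γ v i j * (v i * v j))
      = ∫ w, (∑ i, ∑ j, aker γ (v - w) i j * (v i * v j)) * gaussM w := by
    simp only [abar, ← integral_mul_const]
    simp_rw [← integral_finsetSum _ fun j _ => hi _ j]
    rw [← integral_finsetSum _ fun i _ => integrable_finsetSum _ fun j _ => hi i j]
    congr 1 with w
    simp only [Finset.sum_mul]
    refine Finset.sum_congr rfl fun i _ => Finset.sum_congr rfl fun j _ => by ring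
  rw [h]
  have h0 : ∀ w, 0 ≤ (∑ i, ∑ j, aker γ (v - w) i j * (v i * v j)) * gaussM w := fun w =>
    mul_nonneg (sum_aker_mul_mul_mem hγ v w).1 (gaussM_nonneg w)
  refine ⟨integral_nonneg h0, integral_mono_of_nonneg (ae_of_all _ h0)
    (integrable_Kfun ⟨by linarith [hγ.1], by linarith [hγ.2]⟩ v) (ae_of_all _ fun w => ?_)⟩
  simp only [← mul_assoc]
  exact mul_le_mul_of_nonneg_right (by simpa only [mul_assoc] using (sum_aker_mul_mul_mem hγ v w).2)
    (gaussM_nonneg w)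

lemma sum_bker_mul (hγ : γ ∈ Set.Ioo (-3 : ℝ) (-2)) (v w : V3) :
    ∑ i, bker γ (v - w) i * v i
      = -(‖v - w‖ ^ (γ + 2) + ‖v‖ ^ 2 * ‖v - w‖ ^ γ - ‖v - w‖ ^ γ * ‖w‖ ^ 2) := by
  have h1 := norm_sq_eq_sum_three (v - w)
  have h2 := norm_sq_eq_sum_three w
  have h3 := norm_sq_eq_sum_three v
  have h4 : ‖v - w‖ ^ (γ + 2) = ‖v - w‖ ^ γ * ‖v - w‖ ^ 2 := by
    rw [Real.rpow_add' (norm_nonneg _) (by linarith [hγ.2])]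
    norm_cast
  rw [h4, h1, h2, h3]
  simp only [bker, Fin.sum_univ_three, PiLp.sub_apply]
  ring

lemma sum_bbar_mul (hγ : γ ∈ Set.Ioo (-3 : ℝ) (-2)) (v : V3) :
    ∑ i, bbar γ v i * v i = -(Jfun (γ + 2) v + ‖v‖ ^ 2 * Jfun γ v - Kfun γ v) := by
  have hγ' : γ ∈ Set.Ioo (-3 : ℝ) 0 := ⟨hγ.1, by linarith [hγ.2]⟩
  have hq : γ + 2 ∈ Set.Ioo (-3 : ℝ) 0 := ⟨by linarith [hγ.1], by linarith [hγ.2]⟩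
  have hJ := (integrable_Jfun hγ' v).const_mul (‖v‖ ^ 2)
  have hJJ : Integrable fun w =>
      ‖v - w‖ ^ (γ + 2) * gaussM w + ‖v‖ ^ 2 * (‖v - w‖ ^ γ * gaussM w) :=
    (integrable_Jfun hq v).add hJ
  simp only [bbar, Jfun, Kfun, ← integral_mul_const]
  rw [← integral_finsetSum _ fun i _ => (integrable_bker hγ v i).mul_const (v i),
    ← integral_const_mul, ← integral_add (integrable_Jfun hq v) hJ,
    ← integral_sub hJJ (integrable_Kfun hγ' v), ← integral_neg]
  congr 1 with w
  have h := congrArg (· * gaussM w) (sum_bker_mul hγ v w)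
  simp only [Finset.sum_mul] at h
  rw [Finset.sum_congr rfl fun i _ => mul_right_comm (bker γ (v - w) i) (gaussM w) (v i), h]
  ring

end Coefficients

section Derivatives

lemma hasFDerivAt_jap_rpow (r : ℝ) (v : V3) :
    HasFDerivAt (fun w => jap w ^ r) ((r * jap v ^ (r - 2)) • innerSL ℝ v) v := by
  have hp : ∀ w : V3, 0 ≤ 1 + ‖w‖ ^ 2 := fun w => by positivity
  have hj : ∀ (p : ℝ) (w : V3), jap w ^ p = (1 + ‖w‖ ^ 2) ^ (p / 2) := fun p w => by
    rw [jap, Real.sqrt_eq_rpow, ← Real.rpow_mul (hp w)]; ring_nf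
  have h := ((hasStrictFDerivAt_norm_sq v).hasFDerivAt.const_add 1).rpow_const (p := r / 2)
    (Or.inl (by positivity))
  simp only [hj]
  refine h.congr_fderiv (ContinuousLinearMap.ext fun u => ?_)
  have h2 : (r - 2) / 2 = r / 2 - 1 := by ring
  simp [h2]
  ring

variable (κ s : ℝ)

lemma hasFDerivAt_exp_jap (v : V3) :
    HasFDerivAt (fun w => Real.exp (κ * jap w ^ s))
      ((κ * s * jap v ^ (s - 2) * Real.exp (κ * jap v ^ s)) • innerSL ℝ v) v := by
  refine ((hasFDerivAt_jap_rpow s v).const_mul κ).exp.congr_fderiv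
    (ContinuousLinearMap.ext fun u => ?_)
  simp
  ring

lemma pd_exp_jap (j : Fin 3) :
    pd j (fun w => Real.exp (κ * jap w ^ s))
      = fun v => κ * s * (jap v ^ (s - 2) * v j * Real.exp (κ * jap v ^ s)) := by
  ext v
  rw [pd, (hasFDerivAt_exp_jap κ s v).fderiv]
  simp [EuclideanSpace.inner_single_right]
  ring

lemma pd_pd_exp_jap (i j : Fin 3) (v : V3) :
    pd i (pd j (fun w => Real.exp (κ * jap w ^ s))) v
      = ((κ * s * (s - 2) * jap v ^ (s - 4) + (κ * s * jap v ^ (s - 2)) ^ 2) * (v i * v j)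
        + κ * s * jap v ^ (s - 2) * (if i = j then 1 else 0)) * Real.exp (κ * jap v ^ s) := by
  have hc : HasFDerivAt (fun w : V3 => w j) (EuclideanSpace.proj j : V3 →L[ℝ] ℝ) v :=
    (EuclideanSpace.proj j : V3 →L[ℝ] ℝ).hasFDerivAt
  have h := (((hasFDerivAt_jap_rpow (s - 2) v).mul hc).mul
    (hasFDerivAt_exp_jap κ s v)).const_mul (κ * s)
  have hs : s - 2 - 2 = s - 4 := by ring
  rw [pd_exp_jap, pd]
  erw [h.fderiv]
  by_cases hij : i = j
  · subst hij
    simp [EuclideanSpace.inner_single_right, hs]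
    ring
  · simp [EuclideanSpace.inner_single_right, hs, hij, Ne.symm hij]
    ring

end Derivatives

section Assembly

variable {γ : ℝ} (κ s : ℝ)

lemma sum_sum_abar_pd_pd (hγ : γ ∈ Set.Ioo (-3 : ℝ) (-2)) (v : V3) :
    ∑ i, ∑ j, abar γ v i j * pd i (pd j (fun w => Real.exp (κ * jap w ^ s))) v
        / Real.exp (κ * jap v ^ s)
      = (κ * s * (s - 2) * jap v ^ (s - 4) + (κ * s * jap v ^ (s - 2)) ^ 2)
          * (∑ i, ∑ j, abar γ v i j * (v i * v j))
        + κ * s * jap v ^ (s - 2) * (2 * Jfun (γ + 2) v) := by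
  have he := (Real.exp_pos (κ * jap v ^ s)).ne'
  rw [← sum_abar_diag hγ]
  simp only [pd_pd_exp_jap, mul_div_assoc, div_self he, mul_one]
  simp only [Fin.sum_univ_three, Fin.isValue, Fin.reduceEq, if_true, if_false]
  ring

lemma pd_exp_jap_div (i : Fin 3) (v : V3) :
    pd i (fun w => Real.exp (κ * jap w ^ s)) v / Real.exp (κ * jap v ^ s)
      = κ * s * jap v ^ (s - 2) * v i := by
  rw [pd_exp_jap]
  have he := (Real.exp_pos (κ * jap v ^ s)).ne'
  field_simp

lemma sum_sum_abar_pd_mul_pd (v : V3) :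
    ∑ i, ∑ j, abar γ v i j
        * (pd i (fun w => Real.exp (κ * jap w ^ s)) v / Real.exp (κ * jap v ^ s))
        * (pd j (fun w => Real.exp (κ * jap w ^ s)) v / Real.exp (κ * jap v ^ s))
      = (κ * s * jap v ^ (s - 2)) ^ 2 * (∑ i, ∑ j, abar γ v i j * (v i * v j)) := by
  simp only [pd_exp_jap_div, Finset.mul_sum]
  exact Finset.sum_congr rfl fun i _ => Finset.sum_congr rfl fun j _ => by ring

lemma sum_bbar_pd (v : V3) :
    ∑ i, bbar γ v i * pd i (fun w => Real.exp (κ * jap w ^ s)) v / Real.exp (κ * jap v ^ s)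
      = κ * s * jap v ^ (s - 2) * ∑ i, bbar γ v i * v i := by
  simp only [mul_div_assoc, pd_exp_jap_div, Finset.mul_sum]
  exact Finset.sum_congr rfl fun i _ => by ring

lemma tendsto_jap_rpow_mul_sum_abar {r : ℝ} (hγ : γ ∈ Set.Ioo (-3 : ℝ) (-2)) (hr : r < 0) :
    Tendsto (fun v => jap v ^ r * (jap v ^ (-(γ + 2)) * ∑ i, ∑ j, abar γ v i j * (v i * v j)))
      normAtTop (nhds 0) := by
  have hq : γ + 2 ∈ Set.Ioo (-3 : ℝ) 0 := ⟨by linarith [hγ.1], by linarith [hγ.2]⟩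
  have h := (tendsto_jap_rpow_neg hr).mul (tendsto_Kfun hq)
  rw [zero_mul] at h
  refine squeeze_zero (fun v => ?_) (fun v => ?_) h
  · have := (sum_abar_mul_mul_mem hγ v).1
    have := jap_pos v
    positivity
  · have := (sum_abar_mul_mul_mem hγ v).2
    have := jap_pos v
    gcongr

lemma tendsto_jap_rpow_mul_sum_bbar (hγ : γ ∈ Set.Ioo (-3 : ℝ) (-2)) :
    Tendsto (fun v => jap v ^ (-(γ + 2)) * ∑ i, bbar γ v i * v i) normAtTop (nhds (-2)) := by
  have hγ' : γ ∈ Set.Ioo (-3 : ℝ) 0 := ⟨hγ.1, by linarith [hγ.2]⟩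
  have hq : γ + 2 ∈ Set.Ioo (-3 : ℝ) 0 := ⟨by linarith [hγ.1], by linarith [hγ.2]⟩
  have h0 := tendsto_jap_rpow_neg (r := -2) (by norm_num)
  have h := (((tendsto_Jfun hq).add ((tendsto_Jfun hγ').mul (h0.const_sub 1))).sub
    (h0.mul (tendsto_Kfun hγ'))).neg
  convert h using 1
  · ext v
    have hj := jap_pos v
    have h1 : jap v ^ (-(γ + 2)) = jap v ^ (-2 : ℝ) * jap v ^ (-γ) := by
      rw [← Real.rpow_add hj]; ring_nf
    have h2 : jap v ^ (-2 : ℝ) * jap v ^ 2 = 1 := by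
      rw [← Real.rpow_natCast, ← Real.rpow_add hj]; norm_num
    have h3 : ‖v‖ ^ 2 = jap v ^ 2 - 1 := by rw [jap_sq]; ring
    rw [sum_bbar_mul hγ, h1, h3]
    linear_combination (-jap v ^ (-γ) * Jfun γ v) * h2
  · norm_num

lemma jap_rpow_sub_two_mul (γ : ℝ) (v : V3) :
    jap v ^ (s - 2) * jap v ^ (-s - γ) = jap v ^ (-(γ + 2)) := by
  rw [← Real.rpow_add (jap_pos v)]; ring_nf

lemma jap_rpow_sub_four (v : V3) :
    jap v ^ (s - 4) = jap v ^ (-2 : ℝ) * jap v ^ (s - 2) := by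
  rw [← Real.rpow_add (jap_pos v)]; ring_nf

lemma jap_rpow_neg_sub (γ : ℝ) (v : V3) :
    jap v ^ (-s - γ) = jap v ^ (-s) * jap v ^ (-γ) := by
  rw [← Real.rpow_add (jap_pos v)]; ring_nf

variable {κ s}

lemma tendsto_zetaT (hγ : γ ∈ Set.Ioo (-3 : ℝ) (-2)) (hs : s ∈ Set.Ioo (0 : ℝ) 2) :
    Tendsto (fun v : V3 => zetaT γ (fun w => Real.exp (κ * jap w ^ s)) v * jap v ^ (-s - γ))
      normAtTop (nhds (-2 * κ * s)) := by
  have hγ' : γ ∈ Set.Ioo (-3 : ℝ) 0 := ⟨hγ.1, by linarith [hγ.2]⟩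
  have hA := (tendsto_jap_rpow_mul_sum_abar (r := s - 2) hγ (by linarith [hs.2])).const_mul
    (κ ^ 2 * s ^ 2)
  have hB := (tendsto_jap_rpow_mul_sum_bbar hγ).const_mul (κ * s)
  have hc := ((tendsto_jap_rpow_neg (r := -s) (by linarith [hs.1])).mul
    (tendsto_Jfun hγ')).const_mul (γ + 3)
  convert (hA.add hB).add hc using 1
  · ext v
    have h1 := jap_rpow_sub_two_mul s γ v
    have h3 := jap_rpow_neg_sub s γ v
    simp only [zetaT, sum_sum_abar_pd_mul_pd, sum_bbar_pd, cbar]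
    rw [← h1]
    linear_combination ((γ + 3) * Jfun γ v) * h3
  · congr 1; ring

lemma tendsto_zeta (hγ : γ ∈ Set.Ioo (-3 : ℝ) (-2)) (hs : s ∈ Set.Ioo (0 : ℝ) 2) :
    Tendsto (fun v : V3 => zeta γ (fun w => Real.exp (κ * jap w ^ s)) v * jap v ^ (-s - γ))
      normAtTop (nhds (-2 * κ * s)) := by
  have hγ' : γ ∈ Set.Ioo (-3 : ℝ) 0 := ⟨hγ.1, by linarith [hγ.2]⟩
  have hq : γ + 2 ∈ Set.Ioo (-3 : ℝ) 0 := ⟨by linarith [hγ.1], by linarith [hγ.2]⟩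
  have hJ := (tendsto_Jfun hq).const_mul (2 * κ * s)
  have hA1 := (tendsto_jap_rpow_mul_sum_abar (r := -2) hγ (by norm_num)).const_mul
    (κ * s * (s - 2))
  have hA2 := (tendsto_jap_rpow_mul_sum_abar (r := s - 2) hγ (by linarith [hs.2])).const_mul
    (2 * κ ^ 2 * s ^ 2)
  have hB := (tendsto_jap_rpow_mul_sum_bbar hγ).const_mul (2 * κ * s)
  have hc := ((tendsto_jap_rpow_neg (r := -s) (by linarith [hs.1])).mul
    (tendsto_Jfun hγ')).const_mul (γ + 3)
  convert (((hJ.add hA1).add hA2).add hB).add hc using 1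
  · ext v
    have h1 := jap_rpow_sub_two_mul s γ v
    have h2 := jap_rpow_sub_four s v
    have h3 := jap_rpow_neg_sub s γ v
    simp only [zeta, sum_sum_abar_pd_pd _ _ hγ, sum_sum_abar_pd_mul_pd, sum_bbar_pd, cbar]
    rw [h2, ← h1]
    linear_combination ((γ + 3) * Jfun γ v) * h3
  · congr 1; ring

end Assembly

/-- Lemma 2.2 (2): for the stretched exponential weight m = exp(κ⟨v⟩^s), s ∈ (0,2), κ > 0,
limsup_{|v|→∞} ζ_m(v)⟨v⟩^{−s−γ} ≤ −2κs and the same for ζ̃_m. -/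
theorem stmt8 (γ s κ : ℝ) (hγ : γ ∈ Set.Ioo (-3 : ℝ) (-2)) (hs : s ∈ Set.Ioo (0 : ℝ) 2)
    (hκ : 0 < κ) :
    Filter.limsup
      (fun v : V3 => zeta γ (fun w => Real.exp (κ * jap w ^ s)) v * jap v ^ (-s - γ))
      normAtTop ≤ -2 * κ * s ∧
    Filter.limsup
      (fun v : V3 => zetaT γ (fun w => Real.exp (κ * jap w ^ s)) v * jap v ^ (-s - γ))
      normAtTop ≤ -2 * κ * s := by
  exact ⟨(tendsto_zeta hγ hs).limsup_eq.le, (tendsto_zetaT hγ hs).limsup_eq.le⟩
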